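/- Define u(x₁,x₂) := x₁ − cos(2πx₂) on ℝ². Then for every a > 0 there is NO continuously differentiable function σ : ℝ² → ℝ with σ(x) > 0 for all x and σ(x₁ + a, x₂) = σ(x₁,x₂) for all (x₁,x₂), such that div(σ∇u) = ∂₁(σ ∂₁u) + ∂₂(σ ∂₂u) = 0 everywhere in ℝ². (Example 2.2: the periodic gradient ∇u = (1, 2π sin(2πx₂)) is not isotropically realizable with a conductivity that is periodic in the x₁ direction.) -/

import Mathlib

open Real

/-- A plane flow `(f, g)` with zero classical divergence which is `a`-periodic in the first variable
has the same flux `∫ g` over one period through every horizontal line. -/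
lemma integral_flux_eq_of_divergence_eq_zero {f g : ℝ × ℝ → ℝ} (hf : Differentiable ℝ f)
    (hg : Differentiable ℝ g) {a : ℝ} (hper : ∀ x : ℝ × ℝ, f (x.1 + a, x.2) = f x)
    (hdiv : ∀ x : ℝ × ℝ, deriv (fun t => f (t, x.2)) x.1 + deriv (fun t => g (x.1, t)) x.2 = 0)
    (c d : ℝ) : ∫ s in (0 : ℝ)..a, g (s, d) = ∫ s in (0 : ℝ)..a, g (s, c) := by
  have hzero : ∀ x : ℝ × ℝ, fderiv ℝ f x (1, 0) + fderiv ℝ g x (0, 1) = 0 := by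
    intro x
    have h1 : HasDerivAt (fun t => f (t, x.2)) (fderiv ℝ f x (1, 0)) x.1 :=
      (hf x).hasFDerivAt.comp_hasDerivAt x.1
        ((hasDerivAt_id x.1).prodMk (hasDerivAt_const x.1 x.2))
    have h2 : HasDerivAt (fun t => g (x.1, t)) (fderiv ℝ g x (0, 1)) x.2 :=
      (hg x).hasFDerivAt.comp_hasDerivAt x.2
        ((hasDerivAt_const x.2 x.1).prodMk (hasDerivAt_id x.2))
    rw [← h1.deriv, ← h2.deriv]
    exact hdiv x
  have key := MeasureTheory.integral2_divergence_prod_of_hasFDerivAt f g (fderiv ℝ f)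
    (fderiv ℝ g) 0 c a d hf.continuous.continuousOn hg.continuous.continuousOn
    (fun x _ => (hf x).hasFDerivAt) (fun x _ => (hg x).hasFDerivAt) (by simp [hzero])
  have hside : ∀ y, f (a, y) = f (0, y) := fun y => by simpa using hper (0, y)
  simp only [hzero, hside, intervalIntegral.integral_zero] at key
  linarith

/-- **Example 2.2**: for `u(x₁,x₂) = x₁ - cos(2πx₂)` (so `∇u = (1, 2π sin(2πx₂))`), there is
no positive `C¹` conductivity `σ` on `ℝ²` that is periodic of period `a > 0` in the `x₁`
direction and satisfies `div(σ∇u) = ∂₁(σ ∂₁u) + ∂₂(σ ∂₂u) = 0` everywhere in `ℝ²`. -/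
theorem not_isotropically_realizable_x1_periodic (a : ℝ) (ha : 0 < a) :
    ¬ ∃ σ : ℝ × ℝ → ℝ, ContDiff ℝ 1 σ ∧ (∀ x, 0 < σ x) ∧
      (∀ x : ℝ × ℝ, σ (x.1 + a, x.2) = σ x) ∧
      ∀ x : ℝ × ℝ, deriv (fun t => σ (t, x.2)) x.1
        + deriv (fun t => σ (x.1, t) * (2 * π * Real.sin (2 * π * t))) x.2 = 0 := by
  rintro ⟨σ, hσ, hpos, hper, hdiv⟩
  have hflux := integral_flux_eq_of_divergence_eq_zero (f := σ)
    (g := fun x => σ x * (2 * π * Real.sin (2 * π * x.2)))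
    (hσ.differentiable one_ne_zero)
    ((hσ.differentiable one_ne_zero).mul (by fun_prop)) hper hdiv 0 (1 / 4)
  have hsin : Real.sin (2 * π * (1 / 4)) = 1 := by
    rw [show 2 * π * (1 / 4) = π / 2 by ring, Real.sin_pi_div_two]
  have hcont : Continuous σ := hσ.continuous
  have hflux_pos : 0 < ∫ s in (0 : ℝ)..a, σ (s, 1 / 4) * (2 * π) :=
    intervalIntegral.intervalIntegral_pos_of_pos
      (Continuous.intervalIntegrable (by fun_prop) 0 a)
      (fun s => mul_pos (hpos _) Real.two_pi_pos) ha
  simp only [hsin, mul_one, mul_zero, Real.sin_zero, intervalIntegral.integral_zero] at hflux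
  exact hflux_pos.ne' hflux
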